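/- (Tail worst-case identity, the inductive step of Theorem 1.) In the connected ellipsoidal setting, fix k with 0 ≤ k ≤ T−1 and an admissible prefix (d_1,…,d_k) with induced center μ_{k+1} (for k = 0 take μ₁, the given first-period center). Then the supremum, over all continuations (d_{k+1},…,d_T) that are admissible given the prefix, of Σ_{t=k+1}^T d_tᵀ x_t equals μ_{k+1}ᵀ y_{k+1} + C_{k+1} + R_{k+1}. -/

import Mathlib

open Matrix Finset

/-- The Euclidean norm of a vector in `ℝⁿ`. -/
noncomputable def euclNorm {n : ℕ} (v : Fin n → ℝ) : ℝ := Real.sqrt (∑ i, v i ^ 2)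

theorem dotProduct_le_euclNorm_mul {n : ℕ} (u v : Fin n → ℝ) :
    u ⬝ᵥ v ≤ euclNorm u * euclNorm v :=
  Real.sum_mul_le_sqrt_mul_sqrt _ _ _

theorem euclNorm_smul_of_nonneg {n : ℕ} {a : ℝ} (ha : 0 ≤ a) (v : Fin n → ℝ) :
    euclNorm (a • v) = a * euclNorm v := by
  simp only [euclNorm, Pi.smul_apply, smul_eq_mul, mul_pow, ← Finset.mul_sum]
  rw [Real.sqrt_mul (sq_nonneg a), Real.sqrt_sq ha]

theorem dotProduct_self_eq_euclNorm_sq {n : ℕ} (v : Fin n → ℝ) :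
    v ⬝ᵥ v = euclNorm v ^ 2 := by
  rw [euclNorm, Real.sq_sqrt (Finset.sum_nonneg fun i _ => sq_nonneg (v i))]
  simp only [dotProduct, sq]

/-- A linear functional attains its Cauchy–Schwarz bound on a Euclidean ball. -/
theorem exists_euclNorm_le_dotProduct_eq {n : ℕ} {r : ℝ} (hr : 0 ≤ r) (v : Fin n → ℝ) :
    ∃ u : Fin n → ℝ, euclNorm u ≤ r ∧ u ⬝ᵥ v = r * euclNorm v := by
  have h_nonneg : 0 ≤ euclNorm v := Real.sqrt_nonneg _
  refine ⟨(r / euclNorm v) • v, ?_, ?_⟩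
  · rw [euclNorm_smul_of_nonneg (div_nonneg hr h_nonneg)]
    rcases eq_or_ne (euclNorm v) 0 with h | h
    · simpa [h] using hr
    · exact (div_mul_cancel₀ r h).le
  · rw [smul_dotProduct, dotProduct_self_eq_euclNorm_sq, smul_eq_mul]
    rcases eq_or_ne (euclNorm v) 0 with h | h
    · simp [h]
    · field_simp

/-- One step of the backward recursion: the stage payoff plus the value of the next center. -/
theorem stage_payoff_add_next_center {n : ℕ} (L A F : Matrix (Fin n) (Fin n) ℝ)
    (x y c ν u : Fin n → ℝ) :
    (ν + L *ᵥ u) ⬝ᵥ x + (A *ᵥ ν + F *ᵥ (ν + L *ᵥ u) + c) ⬝ᵥ y =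
      ν ⬝ᵥ (x + (F + A)ᵀ *ᵥ y) + c ⬝ᵥ y + u ⬝ᵥ (Lᵀ *ᵥ (x + Fᵀ *ᵥ y)) := by
  have h_adj : ∀ (M : Matrix (Fin n) (Fin n) ℝ) (v w : Fin n → ℝ),
      v ⬝ᵥ (Mᵀ *ᵥ w) = (M *ᵥ v) ⬝ᵥ w := fun M v w => by
    rw [dotProduct_mulVec, vecMul_transpose]
  simp only [dotProduct_add, h_adj, mulVec_add, add_mulVec, add_dotProduct]
  ring

/-- The total payoff of a tail is affine in the perturbations `u`. -/
theorem sum_tail_payoff_eq {n T : ℕ} {x : ℕ → Fin n → ℝ}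
    {L A F : ℕ → Matrix (Fin n) (Fin n) ℝ} {c y : ℕ → Fin n → ℝ} {C : ℕ → ℝ}
    (hyT : y T = 0) (hy : ∀ j < T, y j = x j + (F j + A j)ᵀ *ᵥ y (j + 1))
    (hCT : C T = 0) (hC : ∀ j < T, C j = c j ⬝ᵥ y (j + 1) + C (j + 1))
    {k : ℕ} (hk : k ≤ T) {e ν u : ℕ → Fin n → ℝ}
    (hν : ∀ t, k ≤ t → ν (t + 1) = A t *ᵥ ν t + F t *ᵥ e t + c t)
    (he : ∀ t, k ≤ t → t < T → e t = ν t + L t *ᵥ u t) :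
    ∑ t ∈ Finset.Ico k T, e t ⬝ᵥ x t =
      ν k ⬝ᵥ y k + C k +
        ∑ t ∈ Finset.Ico k T, u t ⬝ᵥ ((L t)ᵀ *ᵥ (x t + (F t)ᵀ *ᵥ y (t + 1))) := by
  induction hk using Nat.decreasingInduction with
  | self => simp [hyT, hCT]
  | of_succ j hj ih =>
    rw [Finset.sum_eq_sum_Ico_succ_bot hj, Finset.sum_eq_sum_Ico_succ_bot hj,
      ih (fun t ht => hν t (by omega)) (fun t ht => he t (by omega)),
      hν j le_rfl, he j le_rfl hj, hC j hj, hy j hj]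
    linarith [stage_payoff_add_next_center (L j) (A j) (F j) (x j) (y (j + 1)) (c j) (ν j) (u j)]

theorem sum_tail_eq_of_recursion {T : ℕ} {R f : ℕ → ℝ} (hRT : R T = 0)
    (hR : ∀ j < T, R j = f j + R (j + 1)) {k : ℕ} (hk : k ≤ T) :
    R k = ∑ t ∈ Finset.Ico k T, f t := by
  induction hk using Nat.decreasingInduction with
  | self => simp [hRT]
  | of_succ j hj ih => rw [hR j hj, ih, Finset.sum_eq_sum_Ico_succ_bot hj]

/-- A first-order recursion can be started from any value at any time. -/
theorem exists_recursion_from {α : Type*} (g : ℕ → α → α) (k : ℕ) (a : α) :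
    ∃ ν : ℕ → α, ν k = a ∧ ∀ t, k ≤ t → ν (t + 1) = g t (ν t) := by
  refine ⟨fun t => Nat.rec a (fun m b => g (k + m) b) (t - k), by simp, fun t ht => ?_⟩
  obtain ⟨m, rfl⟩ := Nat.exists_eq_add_of_le ht
  simp [Nat.add_assoc]

/-- The tail worst-case identity with the recursions for `y`, `C`, `R` started from `0` at time
`T`. -/
theorem isLUB_tail_payoff_of_terminal_zero {n T : ℕ} {x : ℕ → Fin n → ℝ}
    {L A F : ℕ → Matrix (Fin n) (Fin n) ℝ} {r : ℕ → ℝ} (hr : ∀ t, 0 ≤ r t)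
    {c y : ℕ → Fin n → ℝ} {C R : ℕ → ℝ}
    (hyT : y T = 0) (hy : ∀ j < T, y j = x j + (F j + A j)ᵀ *ᵥ y (j + 1))
    (hCT : C T = 0) (hC : ∀ j < T, C j = c j ⬝ᵥ y (j + 1) + C (j + 1))
    (hRT : R T = 0)
    (hR : ∀ j < T, R j =
      r j * euclNorm ((L j)ᵀ *ᵥ (x j + (F j)ᵀ *ᵥ y (j + 1))) + R (j + 1))
    {k : ℕ} (hk : k ≤ T) (μ : Fin n → ℝ) :
    IsLUB
      {z : ℝ | ∃ e ν : ℕ → Fin n → ℝ,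
        ν k = μ ∧
        (∀ t, k ≤ t → ν (t + 1) = A t *ᵥ ν t + F t *ᵥ e t + c t) ∧
        (∀ t, k ≤ t → t < T → ∃ u : Fin n → ℝ, euclNorm u ≤ r t ∧ e t = ν t + L t *ᵥ u) ∧
        z = ∑ t ∈ Finset.Ico k T, e t ⬝ᵥ x t}
      (μ ⬝ᵥ y k + C k + R k) := by
  refine IsGreatest.isLUB ⟨?_, ?_⟩
  · choose u hu_le hu_eq using fun t =>
      exists_euclNorm_le_dotProduct_eq (hr t) ((L t)ᵀ *ᵥ (x t + (F t)ᵀ *ᵥ y (t + 1)))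
    obtain ⟨ν, hνk, hν⟩ := exists_recursion_from
      (fun t v => A t *ᵥ v + F t *ᵥ (v + L t *ᵥ u t) + c t) k μ
    refine ⟨fun t => ν t + L t *ᵥ u t, ν, hνk, hν, fun t _ _ => ⟨u t, hu_le t, rfl⟩, ?_⟩
    rw [sum_tail_payoff_eq hyT hy hCT hC hk hν fun _ _ _ => rfl, hνk,
      sum_tail_eq_of_recursion hRT hR hk]
    simp only [hu_eq]
  · rintro z ⟨e, ν, hνk, hν, he, rfl⟩
    choose! u hu_le hu_eq using he
    rw [sum_tail_payoff_eq hyT hy hCT hC hk hν hu_eq, hνk, sum_tail_eq_of_recursion hRT hR hk]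
    gcongr with t ht
    obtain ⟨hkt, htT⟩ := Finset.mem_Ico.mp ht
    exact (dotProduct_le_euclNorm_mul _ _).trans
      (mul_le_mul_of_nonneg_right (hu_le t hkt htT) (Real.sqrt_nonneg _))

/-- Tail worst-case identity (inductive step of Theorem 1), connected ellipsoidal
setting, 0-indexed: periods `0,…,T-1` correspond to `1,…,T`, and the prefix consists
of the periods `< k` (so `k = 0` is the empty prefix).  Given an admissible prefix
`d_0,…,d_{k-1}` with centers `μpre` generated by the recursion from `μ₁`, the supremum
over admissible continuations `e_k,…,e_{T-1}` (with centers restarted from the induced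
center `μpre k`) of `Σ_{t=k}^{T-1} e_tᵀ x_t` equals `μpre kᵀ y_k + C_k + R_k`. -/
theorem connected_ellipsoid_tail_worst_case
    (n T : ℕ) (hn : 1 ≤ n) (hT : 1 ≤ T)
    (x : ℕ → Fin n → ℝ) (L A F : ℕ → Matrix (Fin n) (Fin n) ℝ)
    (r : ℕ → ℝ) (hr : ∀ t, 0 ≤ r t) (c : ℕ → Fin n → ℝ) (μ₁ : Fin n → ℝ)
    (y : ℕ → Fin n → ℝ) (C R : ℕ → ℝ)
    (hyT : y (T - 1) = x (T - 1))
    (hy : ∀ j, j + 1 < T → y j = x j + (F j + A j)ᵀ *ᵥ y (j + 1))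
    (hCT : C (T - 1) = 0)
    (hC : ∀ j, j + 1 < T → C j = c j ⬝ᵥ y (j + 1) + C (j + 1))
    (hRT : R (T - 1) = r (T - 1) * euclNorm ((L (T - 1))ᵀ *ᵥ x (T - 1)))
    (hR : ∀ j, j + 1 < T →
      R j = r j * euclNorm ((L j)ᵀ *ᵥ (x j + (F j)ᵀ *ᵥ y (j + 1))) + R (j + 1))
    (k : ℕ) (hk : k < T)
    (d μpre : ℕ → Fin n → ℝ)
    (hμ0 : μpre 0 = μ₁)
    (hμrec : ∀ t, μpre (t + 1) = A t *ᵥ μpre t + F t *ᵥ d t + c t)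
    (hprefix : ∀ t < k, ∃ u : Fin n → ℝ, euclNorm u ≤ r t ∧ d t = μpre t + L t *ᵥ u) :
    IsLUB
      {z : ℝ | ∃ e ν : ℕ → Fin n → ℝ,
        ν k = μpre k ∧
        (∀ t, k ≤ t → ν (t + 1) = A t *ᵥ ν t + F t *ᵥ e t + c t) ∧
        (∀ t, k ≤ t → t < T → ∃ u : Fin n → ℝ, euclNorm u ≤ r t ∧ e t = ν t + L t *ᵥ u) ∧
        z = ∑ t ∈ Finset.Ico k T, e t ⬝ᵥ x t}
      (μpre k ⬝ᵥ y k + C k + R k) := by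
  have h_last : ∀ j < T, ¬ j + 1 < T → j = T - 1 := fun j hj hj' => by omega
  have h_main := isLUB_tail_payoff_of_terminal_zero (T := T) (x := x) (L := L) (A := A) (F := F)
    (c := c) hr
    (y := fun t => if t < T then y t else 0) (C := fun t => if t < T then C t else 0)
    (R := fun t => if t < T then R t else 0) (by simp) ?_ (by simp) ?_ (by simp) ?_
    hk.le (μpre k)
  · simpa only [hk, if_true] using h_main
  all_goals
    intro j hj
    by_cases hj' : j + 1 < T
    · simp only [hj, hj', if_true]
      first
        | exact hy j hj'
        | exact hC j hj'
        | exact hR j hj'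
    · obtain rfl := h_last j hj hj'
      simp only [hj, hj', if_true, if_false, mulVec_zero, dotProduct_zero, add_zero]
      assumption
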